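/- There exist permutations σ₀, σ₁, σ∞, σ_t of a set with 12 elements such that: σ₀ is a product of 6 disjoint transpositions (cycle type consisting of six 2's); σ₁ is a product of 3 disjoint 4-cycles (cycle type {4,4,4}); σ∞ is a product of 2 disjoint 6-cycles (cycle type {6,6}); σ_t is a transposition (cycle type {2}); the composition σ₀ ∘ σ₁ ∘ σ∞ ∘ σ_t is the identity; and the subgroup generated by σ₀, σ₁, σ∞ acts transitively on the 12 points. -/

import Mathlib

theorem cycleType_formPerm_aux (l : List (Fin 12)) (hl : l.Nodup) (hn : 2 ≤ l.length) :
    l.formPerm.cycleType = {l.length} := by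
  rw [(List.isCycle_formPerm hl hn).cycleType, List.support_formPerm_of_nodup l hl,
    List.toFinset_card_of_nodup hl]
  intro x hx
  simp [hx] at hn


/-- Existence of permutations encoding a degree 12 branched covering of the projective line
realizing the Hurwitz data (2,4,6) of the paper, with one free simple branch point:
cycle types of σ₀, σ₁, σ∞ are as prescribed, σ_t is a transposition, the composition
σ₀ ∘ σ₁ ∘ σ∞ ∘ σ_t is the identity, and ⟨σ₀, σ₁, σ∞⟩ is transitive on the 12 points. -/
theorem stmt10 :
    ∃ σ₀ σ₁ σ_inf σ_t : Equiv.Perm (Fin 12),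
      σ₀.cycleType = (Multiset.replicate 6 2) ∧
      σ₁.cycleType = {4, 4, 4} ∧
      σ_inf.cycleType = {6, 6} ∧
      σ_t.cycleType = {2} ∧
      σ₀ * σ₁ * σ_inf * σ_t = 1 ∧
      ∀ i j : Fin 12, ∃ g ∈ Subgroup.closure ({σ₀, σ₁, σ_inf} : Set (Equiv.Perm (Fin 12))),
        g i = j := by
  refine ⟨[(0 : Fin 12), 9].formPerm * [(1 : Fin 12), 3].formPerm * [(2 : Fin 12), 6].formPerm * [(4 : Fin 12), 10].formPerm * [(5 : Fin 12), 7].formPerm * [(8 : Fin 12), 11].formPerm,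
    [(0 : Fin 12), 3, 10, 8].formPerm * [(1 : Fin 12), 6, 5, 2].formPerm * [(4 : Fin 12), 7, 11, 9].formPerm,
    [(0 : Fin 12), 5, 4, 3, 2, 1].formPerm * [(6 : Fin 12), 11, 10, 9, 8, 7].formPerm,
    [(0 : Fin 12), 6].formPerm, ?_, ?_, ?_, ?_, by ext i; revert i; decide +kernel, ?_⟩
  · rw [Equiv.Perm.Disjoint.cycleType_mul (by unfold Equiv.Perm.Disjoint; decide), Equiv.Perm.Disjoint.cycleType_mul (by unfold Equiv.Perm.Disjoint; decide), Equiv.Perm.Disjoint.cycleType_mul (by unfold Equiv.Perm.Disjoint; decide), Equiv.Perm.Disjoint.cycleType_mul (by unfold Equiv.Perm.Disjoint; decide), Equiv.Perm.Disjoint.cycleType_mul (by unfold Equiv.Perm.Disjoint; decide), cycleType_formPerm_aux _ (by decide) (by decide), cycleType_formPerm_aux _ (by decide) (by decide), cycleType_formPerm_aux _ (by decide) (by decide), cycleType_formPerm_aux _ (by decide) (by decide), cycleType_formPerm_aux _ (by decide) (by decide), cycleType_formPerm_aux _ (by decide) (by decide)]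
    decide
  · rw [Equiv.Perm.Disjoint.cycleType_mul (by unfold Equiv.Perm.Disjoint; decide), Equiv.Perm.Disjoint.cycleType_mul (by unfold Equiv.Perm.Disjoint; decide), cycleType_formPerm_aux _ (by decide) (by decide), cycleType_formPerm_aux _ (by decide) (by decide), cycleType_formPerm_aux _ (by decide) (by decide)]
    decide
  · rw [Equiv.Perm.Disjoint.cycleType_mul (by unfold Equiv.Perm.Disjoint; decide), cycleType_formPerm_aux _ (by decide) (by decide), cycleType_formPerm_aux _ (by decide) (by decide)]
    decide
  · exact cycleType_formPerm_aux _ (by decide) (by decide)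
  · intro i j
    refine ⟨(([(0 : Fin 12), 9].formPerm * [(1 : Fin 12), 3].formPerm * [(2 : Fin 12), 6].formPerm * [(4 : Fin 12), 10].formPerm * [(5 : Fin 12), 7].formPerm * [(8 : Fin 12), 11].formPerm) * ([(0 : Fin 12), 3, 10, 8].formPerm * [(1 : Fin 12), 6, 5, 2].formPerm * [(4 : Fin 12), 7, 11, 9].formPerm)) ^ ((j - i : Fin 12) : ℕ), ?_, ?_⟩
    · refine pow_mem (mul_mem ?_ ?_) _ <;> apply Subgroup.subset_closure <;> simp
    · revert i j
      decide +kernel
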